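/- There is no linear isometry φ of (Fin 2 → ℝ) equipped with the supremum norm ‖x‖∞ = max(|x₀|, |x₁|) such that φ has order 3, i.e., such that φ³ = id and φ ≠ id. -/

import Mathlib

lemma norm_fin_two_aux (v : Fin 2 → ℝ) : ‖v‖ = max |v 0| |v 1| := by
  apply le_antisymm
  · rw [pi_norm_le_iff_of_nonneg (le_max_of_le_left (abs_nonneg _))]
    intro i
    fin_cases i <;> simp
  · exact max_le (norm_le_pi_norm v 0) (norm_le_pi_norm v 1)

lemma entries_aux (a b c d : ℝ) (h1 : max |a| |c| = 1) (h2 : max |b| |d| = 1)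
    (h3 : max |a + b| |c + d| = 1) (h4 : max |a - b| |c - d| = 1) :
    ((a = 1 ∨ a = -1) ∧ b = 0 ∧ c = 0 ∧ (d = 1 ∨ d = -1)) ∨ (a = 0 ∧ d = 0) := by
  have p1 := abs_le.1 (h3 ▸ le_max_left |a + b| |c + d|)
  have p2 := abs_le.1 (h3 ▸ le_max_right |a + b| |c + d|)
  have p3 := abs_le.1 (h4 ▸ le_max_left |a - b| |c - d|)
  have p4 := abs_le.1 (h4 ▸ le_max_right |a - b| |c - d|)
  have q1 : |a| = 1 ∨ |c| = 1 := by
    rcases max_choice |a| |c| with h | h <;> rw [h] at h1 <;> simp [h1]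
  have q2 : |b| = 1 ∨ |d| = 1 := by
    rcases max_choice |b| |d| with h | h <;> rw [h] at h2 <;> simp [h2]
  simp only [abs_eq (zero_le_one' ℝ)] at q1 q2
  clear h1 h2 h3 h4
  obtain ⟨p1, p1'⟩ := p1
  obtain ⟨p2, p2'⟩ := p2
  obtain ⟨p3, p3'⟩ := p3
  obtain ⟨p4, p4'⟩ := p4
  rcases q1 with h | h
  · left
    have hb : b = 0 := by rcases h with h | h <;> linarith
    have hd : d = 1 ∨ d = -1 := by
      rcases q2 with (h' | h') | h'
      · linarith
      · linarith
      · exact h'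
    have hc : c = 0 := by rcases hd with h | h <;> linarith
    exact ⟨h, hb, hc, hd⟩
  · right
    have hd : d = 0 := by rcases h with h | h <;> linarith
    have hb : b = 1 ∨ b = -1 := by
      rcases q2 with h' | (h' | h')
      · exact h'
      · linarith
      · linarith
    have ha : a = 0 := by rcases hb with h | h <;> linarith
    exact ⟨ha, hd⟩

/-- There is no linear isometry of `ℝ²` with the supremum norm having order `3`. -/
theorem no_order_three_linear_isometry_of_linfty_plane :
    ¬ ∃ φ : (Fin 2 → ℝ) →ₗ[ℝ] (Fin 2 → ℝ),
      (∀ x : Fin 2 → ℝ, ‖φ x‖ = ‖x‖) ∧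
      φ ∘ₗ φ ∘ₗ φ = LinearMap.id ∧
      φ ≠ LinearMap.id := by
  rintro ⟨φ, hn, h3, hne⟩
  obtain ⟨a, b, c, d, hφ⟩ : ∃ a b c d : ℝ, ∀ x, φ x = ![a * x 0 + b * x 1, c * x 0 + d * x 1] := by
    refine ⟨φ ![1, 0] 0, φ ![0, 1] 0, φ ![1, 0] 1, φ ![0, 1] 1, fun x => ?_⟩
    have hx : x = x 0 • ![1, 0] + x 1 • ![0, 1] := by
      ext i
      fin_cases i <;> simp
    conv_lhs => rw [hx, map_add, map_smul, map_smul]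
    ext i
    fin_cases i <;> simp [mul_comm]
  have e1 := hn ![1, 0]
  have e2 := hn ![0, 1]
  have e3 := hn ![1, 1]
  have e4 := hn ![1, -1]
  have f1 := LinearMap.congr_fun h3 ![1, 0]
  have f2 := LinearMap.congr_fun h3 ![0, 1]
  simp only [hφ, norm_fin_two_aux] at e1 e2 e3 e4
  simp only [LinearMap.comp_apply, hφ, LinearMap.id_apply] at f1 f2
  have g1 := congrFun f1 0
  have g2 := congrFun f2 1
  clear f1 f2
  simp at e1 e2 e3 e4 g1 g2
  rcases entries_aux a b c d e1 e2 e3 (by simpa [sub_eq_add_neg] using e4) with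
    ⟨ha, rfl, rfl, hd⟩ | ⟨rfl, rfl⟩
  · have ha' : a = 1 := by
      rcases ha with rfl | rfl
      · rfl
      · norm_num at g1
    have hd' : d = 1 := by
      rcases hd with rfl | rfl
      · rfl
      · norm_num at g2
    subst ha' hd'
    apply hne
    apply LinearMap.ext
    intro x
    rw [hφ]
    ext i
    fin_cases i <;> simp
  · norm_num at g1
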